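/- arXiv:2207.13903 — 2 statements merged into one kernel-verified Lean document; each statement's English description precedes it below -/
import Mathlib

section
/- Let b_0 > 0, let b_1, …, b_k be distinct positive real numbers, let m_1, …, m_k be positive integers, let q(x) = b_0·∏_{i=1}^k (x + b_i)^{m_i} be a nonconstant polynomial, let p be a real polynomial taking values in (0,∞) on ℝ₊ with deg p ≤ deg q, and let c_0 ≥ 0 and c_{ij} ∈ ℝ be the coefficients of the partial fraction decomposition p(x)/q(x) = c_0 + ∑_{i=1}^k ∑_{j=1}^{m_i} c_{ij}/(x + b_i)^j on ℝ₊. If ∑_{i=1}^k ∑_{j=1}^{m_i} (c_{ij}/(j−1)!)·(−log s)^{j−1}·s^{b_i} ≤ 0 for every s ∈ (0,1), then for every t ∈ (0,1) the sequence {t^{p(n)/q(n)}}_{n ∈ ℤ₊} is completely monotone. -/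
noncomputable section

open Polynomial

/-- Forward difference operator for sequences. -/
def dSeq (s : ℕ → ℝ) : ℕ → ℝ := fun m => s (m + 1) - s m

/-- A sequence is completely monotone. -/
def CompMono (s : ℕ → ℝ) : Prop := ∀ k m : ℕ, 0 ≤ (-1 : ℝ) ^ k * dSeq^[k] s m

theorem dSeq_iterate_add (k : ℕ) (s t : ℕ → ℝ) (m : ℕ) :
    dSeq^[k] (fun n => s n + t n) m = dSeq^[k] s m + dSeq^[k] t m := by
  induction k generalizing s t with
  | zero => rfl
  | succ k ih =>
    have h : dSeq (fun n => s n + t n) = fun n => dSeq s n + dSeq t n := by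
      funext n; simp only [dSeq]; ring
    rw [Function.iterate_succ_apply, h, ih]
    rfl

theorem dSeq_iterate_const_mul (k : ℕ) (a : ℝ) (s : ℕ → ℝ) (m : ℕ) :
    dSeq^[k] (fun n => a * s n) m = a * dSeq^[k] s m := by
  induction k generalizing s with
  | zero => rfl
  | succ k ih =>
    have h : dSeq (fun n => a * s n) = fun n => a * dSeq s n := by
      funext n; simp only [dSeq]; ring
    rw [Function.iterate_succ_apply, h, ih]
    rfl

theorem dSeq_iterate_shift (k : ℕ) (s : ℕ → ℝ) (m : ℕ) :
    dSeq^[k] (fun n => s (n + 1)) m = dSeq^[k] s (m + 1) := by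
  induction k generalizing s with
  | zero => rfl
  | succ k ih => exact ih (dSeq s)

theorem neg_one_pow_succ_mul_dSeq_iterate (k : ℕ) (s : ℕ → ℝ) (m : ℕ) :
    (-1 : ℝ) ^ (k + 1) * dSeq^[k + 1] s m =
      (-1 : ℝ) ^ k * dSeq^[k] (fun n => s n - s (n + 1)) m := by
  have h : (fun n => s n - s (n + 1)) = fun n => (-1 : ℝ) * dSeq s n := by
    funext n; simp only [dSeq]; ring
  rw [h, dSeq_iterate_const_mul, Function.iterate_succ_apply]
  ring

theorem tendsto_dSeq_iterate {S : ℕ → ℕ → ℝ} {s : ℕ → ℝ}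
    (h : ∀ n, Filter.Tendsto (fun N => S N n) Filter.atTop (nhds (s n))) (k m : ℕ) :
    Filter.Tendsto (fun N => dSeq^[k] (S N) m) Filter.atTop (nhds (dSeq^[k] s m)) := by
  induction k generalizing S s with
  | zero => exact h m
  | succ k ih => exact ih fun n => (h (n + 1)).sub (h n)

namespace CompMono

variable {s t : ℕ → ℝ}

theorem nonneg (hs : CompMono s) (m : ℕ) : 0 ≤ s m := by simpa using hs 0 m

theorem sub_shift (hs : CompMono s) : CompMono fun n => s n - s (n + 1) := fun k m => by
  rw [← neg_one_pow_succ_mul_dSeq_iterate]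
  exact hs (k + 1) m

theorem shift (hs : CompMono s) : CompMono fun n => s (n + 1) := fun k m => by
  rw [dSeq_iterate_shift]
  exact hs k (m + 1)

theorem add (hs : CompMono s) (ht : CompMono t) : CompMono fun n => s n + t n := fun k m => by
  rw [dSeq_iterate_add, mul_add]
  exact add_nonneg (hs k m) (ht k m)

theorem const_mul {a : ℝ} (ha : 0 ≤ a) (hs : CompMono s) : CompMono fun n => a * s n :=
  fun k m => by
    rw [dSeq_iterate_const_mul, mul_left_comm]
    exact mul_nonneg ha (hs k m)

theorem one : CompMono fun _ => 1 := by
  intro k m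
  cases k with
  | zero => simp
  | succ k =>
    have h := dSeq_iterate_const_mul k 0 (fun _ => 0) m
    rw [neg_one_pow_succ_mul_dSeq_iterate]
    simp only [zero_mul, sub_self] at h ⊢
    simp [h]

theorem mul (hs : CompMono s) (ht : CompMono t) : CompMono fun n => s n * t n := by
  intro k
  induction k generalizing s t with
  | zero =>
    intro m
    simpa using mul_nonneg (hs.nonneg m) (ht.nonneg m)
  | succ k ih =>
    intro m
    have h : (fun n => s n * t n - s (n + 1) * t (n + 1)) =
        fun n => (s n - s (n + 1)) * t n + s (n + 1) * (t n - t (n + 1)) := by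
      funext n; ring
    rw [neg_one_pow_succ_mul_dSeq_iterate, h, dSeq_iterate_add, mul_add]
    exact add_nonneg (ih hs.sub_shift ht m) (ih hs.shift ht.sub_shift m)

theorem pow (hs : CompMono s) (N : ℕ) : CompMono fun n => s n ^ N := by
  induction N with
  | zero => simpa using one
  | succ N ih => simpa only [pow_succ] using ih.mul hs

theorem of_tendsto {S : ℕ → ℕ → ℝ} (hS : ∀ N, CompMono (S N))
    (h : ∀ n, Filter.Tendsto (fun N => S N n) Filter.atTop (nhds (s n))) : CompMono s :=
  fun k m => ge_of_tendsto' ((tendsto_dSeq_iterate h k m).const_mul _) fun N => hS N k m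

theorem exp (hs : CompMono s) : CompMono fun n => Real.exp (s n) := by
  refine of_tendsto (S := fun N n => (1 + s n / N) ^ N) (fun N => ?_)
    fun n => Real.tendsto_one_add_div_pow_exp (s n)
  have h := (one.add (hs.const_mul (a := (N : ℝ)⁻¹) (by positivity))).pow N
  simpa only [div_eq_inv_mul] using h

end CompMono

open MeasureTheory Set

theorem integrableOn_exp_neg_mul_mul {h : ℝ → ℝ} (hi : IntegrableOn h (Ioi 0)) (n : ℕ) :
    IntegrableOn (fun u => Real.exp (-(n * u)) * h u) (Ioi 0) := by
  refine Integrable.bdd_mul (c := 1) hi (by fun_prop) ?_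
  filter_upwards [ae_restrict_mem measurableSet_Ioi] with u hu
  have hu' : 0 < u := hu
  rw [Real.norm_eq_abs, Real.abs_exp, Real.exp_le_one_iff]
  have : 0 ≤ (n : ℝ) * u := by positivity
  linarith

/-- The Laplace transform of a nonnegative integrable function, restricted to the natural
numbers, is completely monotone. -/
theorem compMono_laplace {h : ℝ → ℝ} (hi : IntegrableOn h (Ioi 0)) (h0 : ∀ u, 0 < u → 0 ≤ h u) :
    CompMono fun n => ∫ u in Ioi (0 : ℝ), Real.exp (-(n * u)) * h u := by
  intro k
  induction k generalizing h with
  | zero =>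
    intro m
    simpa using setIntegral_nonneg (μ := volume) measurableSet_Ioi
      fun u hu => mul_nonneg (Real.exp_pos (-(m * u))).le (h0 u hu)
  | succ k ih =>
    intro m
    have hexp := integrableOn_exp_neg_mul_mul hi 1
    have hi' : IntegrableOn (fun u => h u - Real.exp (-((1 : ℕ) * u)) * h u) (Ioi 0) :=
      hi.sub hexp
    have h0' : ∀ u, 0 < u → 0 ≤ h u - Real.exp (-((1 : ℕ) * u)) * h u := fun u hu => by
      have h1 : Real.exp (-((1 : ℕ) * u)) ≤ 1 := by
        rw [Real.exp_le_one_iff]; push_cast; linarith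
      nlinarith [h0 u hu]
    have key := ih hi' h0' m
    rw [neg_one_pow_succ_mul_dSeq_iterate]
    convert key using 4 with n
    rw [← integral_sub (integrableOn_exp_neg_mul_mul hi n)
      (integrableOn_exp_neg_mul_mul hi (n + 1))]
    refine integral_congr_ae (Filter.Eventually.of_forall fun u => ?_)
    have h2 : Real.exp (-(((n + 1 : ℕ) : ℝ) * u)) =
        Real.exp (-(n * u)) * Real.exp (-((1 : ℕ) * u)) := by
      rw [← Real.exp_add]; push_cast; ring_nf
    simp only [h2]
    ring

theorem integrableOn_pow_mul_exp_neg_mul (j : ℕ) {r : ℝ} (hr : 0 < r) :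
    IntegrableOn (fun u : ℝ => u ^ j * Real.exp (-(r * u))) (Ioi 0) := by
  have h := integrableOn_rpow_mul_exp_neg_mul_rpow (s := (j : ℝ)) (p := 1) (b := r)
    (by linarith [(Nat.cast_nonneg j : (0 : ℝ) ≤ j)]) one_pos hr
  simpa only [Real.rpow_natCast, Real.rpow_one, neg_mul] using h

theorem integral_pow_mul_exp_neg_mul (j : ℕ) {r : ℝ} (hr : 0 < r) :
    ∫ u in Ioi (0 : ℝ), u ^ j * Real.exp (-(r * u)) = (j.factorial : ℝ) / r ^ (j + 1) := by
  have h := Real.integral_rpow_mul_exp_neg_mul_Ioi (a := (j : ℝ) + 1) (by positivity) hr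
  simp only [add_sub_cancel_right, Real.rpow_natCast, Real.Gamma_nat_eq_factorial] at h
  rw [h, ← Nat.cast_succ, Real.rpow_natCast, one_div, inv_pow]
  field_simp

/-- The density whose Laplace transform is
`∑ i ∈ Icc 1 k, ∑ j ∈ Icc 1 (m i), c i j / (x + B i) ^ j`. -/
def partialFractionDensity (k : ℕ) (m : ℕ → ℕ) (B : ℕ → ℝ) (c : ℕ → ℕ → ℝ) (u : ℝ) : ℝ :=
  ∑ i ∈ Finset.Icc 1 k, ∑ j ∈ Finset.Icc 1 (m i),
    c i j / ((j - 1).factorial : ℝ) * (u ^ (j - 1) * Real.exp (-(B i * u)))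

theorem integrableOn_partialFractionDensity {k : ℕ} {m : ℕ → ℕ} {B : ℕ → ℝ} {c : ℕ → ℕ → ℝ}
    (hB : ∀ i, 1 ≤ i → i ≤ k → 0 < B i) :
    IntegrableOn (partialFractionDensity k m B c) (Ioi 0) := by
  refine integrable_finsetSum _ fun i hi => integrable_finsetSum _ fun j _ => ?_
  rw [Finset.mem_Icc] at hi
  exact (integrableOn_pow_mul_exp_neg_mul (j - 1) (hB i hi.1 hi.2)).const_mul _

theorem laplace_partialFractionDensity {k : ℕ} {m : ℕ → ℕ} {B : ℕ → ℝ} {c : ℕ → ℕ → ℝ}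
    (hB : ∀ i, 1 ≤ i → i ≤ k → 0 < B i) {x : ℝ} (hx : 0 ≤ x) :
    ∫ u in Ioi (0 : ℝ), Real.exp (-(x * u)) * partialFractionDensity k m B c u =
      ∑ i ∈ Finset.Icc 1 k, ∑ j ∈ Finset.Icc 1 (m i), c i j / (x + B i) ^ j := by
  have hexp : ∀ u, Real.exp (-(x * u)) * partialFractionDensity k m B c u =
      partialFractionDensity k m (fun i => x + B i) c u := fun u => by
    simp only [partialFractionDensity, Finset.mul_sum]
    refine Finset.sum_congr rfl fun i _ => Finset.sum_congr rfl fun j _ => ?_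
    rw [show -((x + B i) * u) = -(x * u) + -(B i * u) by ring, Real.exp_add]
    ring
  have hpos : ∀ i ∈ Finset.Icc 1 k, 0 < x + B i := fun i hi => by
    rw [Finset.mem_Icc] at hi
    linarith [hB i hi.1 hi.2]
  have hint : ∀ i ∈ Finset.Icc 1 k, ∀ j ∈ Finset.Icc 1 (m i),
      IntegrableOn (fun u : ℝ => c i j / ((j - 1).factorial : ℝ) *
        (u ^ (j - 1) * Real.exp (-((x + B i) * u)))) (Ioi 0) := fun i hi j _ =>
    (integrableOn_pow_mul_exp_neg_mul (j - 1) (hpos i hi)).const_mul _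
  simp_rw [hexp]
  simp only [partialFractionDensity]
  rw [integral_finsetSum _ fun i hi => integrable_finsetSum _ (hint i hi)]
  refine Finset.sum_congr rfl fun i hi => ?_
  rw [integral_finsetSum _ (hint i hi)]
  refine Finset.sum_congr rfl fun j hj => ?_
  rw [integral_const_mul, integral_pow_mul_exp_neg_mul _ (hpos i hi),
    Nat.sub_add_cancel (Finset.mem_Icc.1 hj).1]
  have := Nat.factorial_ne_zero (j - 1)
  field_simp

theorem statement5 (k : ℕ) (hk : 0 < k) (b₀ : ℝ) (hb₀ : 0 < b₀)
    (B : ℕ → ℝ) (hB : ∀ i, 1 ≤ i → i ≤ k → 0 < B i)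
    (hdist : ∀ i ∈ Finset.Icc 1 k, ∀ j ∈ Finset.Icc 1 k, i ≠ j → B i ≠ B j)
    (m : ℕ → ℕ) (hm : ∀ i, 1 ≤ i → i ≤ k → 1 ≤ m i)
    (q : Polynomial ℝ)
    (hq : q = C b₀ * ∏ i ∈ Finset.Icc 1 k, (X + C (B i)) ^ m i)
    (hqnc : 0 < q.natDegree)
    (p : Polynomial ℝ) (hp : ∀ x : ℝ, 0 ≤ x → 0 < p.eval x)
    (hdeg : p.natDegree ≤ q.natDegree)
    (c₀ : ℝ) (hc₀ : 0 ≤ c₀) (c : ℕ → ℕ → ℝ)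
    (hdec : ∀ x : ℝ, 0 ≤ x →
      p.eval x / q.eval x =
        c₀ + ∑ i ∈ Finset.Icc 1 k, ∑ j ∈ Finset.Icc 1 (m i), c i j / (x + B i) ^ j)
    (hneg : ∀ s : ℝ, s ∈ Set.Ioo (0 : ℝ) 1 →
      ∑ i ∈ Finset.Icc 1 k, ∑ j ∈ Finset.Icc 1 (m i),
        (c i j / (Nat.factorial (j - 1) : ℝ)) * (-Real.log s) ^ (j - 1) * s ^ (B i) ≤ 0) :
    ∀ t : ℝ, t ∈ Set.Ioo (0 : ℝ) 1 →
      CompMono (fun n => t ^ (p.eval (n : ℝ) / q.eval (n : ℝ))) := by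
  intro t ht
  have h0 : ∀ u, 0 < u → 0 ≤ -partialFractionDensity k m B c u := fun u hu => by
    have h := hneg (Real.exp (-u)) ⟨Real.exp_pos _, by rw [Real.exp_lt_one_iff]; linarith⟩
    simp only [Real.log_exp, neg_neg, ← Real.exp_mul, mul_assoc, neg_mul, mul_comm u] at h
    rw [neg_nonneg]
    exact h
  have hg := compMono_laplace (integrableOn_partialFractionDensity hB).neg h0
  have hlog : 0 ≤ -Real.log t := by linarith [Real.log_neg ht.1 ht.2]
  have hmain := ((hg.const_mul hlog).exp).const_mul (Real.exp_pos (Real.log t * c₀)).le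
  convert hmain using 2 with n
  rw [Real.rpow_def_of_pos ht.1, ← Real.exp_add, hdec n n.cast_nonneg,
    ← laplace_partialFractionDensity hB n.cast_nonneg]
  simp only [Pi.neg_apply, mul_neg, integral_neg]
  ring_nf
end
end

section
/- Let k be a positive integer, let a_0, b_0 > 0 and a_1, …, a_k, b_1, …, b_k > 0, and set a(x) = a_0·∏_{j=1}^k (x + a_j) and b(x) = b_0·∏_{j=1}^k (x + b_j) for x ≥ 0. If the double net {1/(b(m) + a(m)·n)}_{m,n ∈ ℤ₊} is joint completely monotone, then it is a minimal joint completely monotone net. -/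
noncomputable section

/-- A completely monotone sequence is minimal. -/
def MinCompMono (s : ℕ → ℝ) : Prop :=
  CompMono s ∧ ∀ ε : ℝ, 0 < ε → ¬ CompMono (fun k => s k - if k = 0 then ε else 0)

/-- First forward difference operator for double nets. -/
def d1 (a : ℕ → ℕ → ℝ) : ℕ → ℕ → ℝ := fun m n => a (m + 1) n - a m n

/-- Second forward difference operator for double nets. -/
def d2 (a : ℕ → ℕ → ℝ) : ℕ → ℕ → ℝ := fun m n => a m (n + 1) - a m n

/-- A double net is joint completely monotone. -/
def JointCompMono (a : ℕ → ℕ → ℝ) : Prop :=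
  ∀ β₁ β₂ m n : ℕ, 0 ≤ (-1 : ℝ) ^ (β₁ + β₂) * d1^[β₁] (d2^[β₂] a) m n

/-- A joint completely monotone double net is minimal. -/
def MinJointCompMono (a : ℕ → ℕ → ℝ) : Prop :=
  JointCompMono a ∧
    (∀ ε : ℝ, 0 < ε → ¬ CompMono (fun k => a k 0 - if k = 0 then ε else 0)) ∧
    (∀ ε : ℝ, 0 < ε → ¬ CompMono (fun k => a 0 k - if k = 0 then ε else 0))

open MeasureTheory Filter Topology

/-- The sequence `s` is the moment sequence of a `(0, 1]`-valued function on a finite measure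
space; equivalently, its representing measure on `[0, 1]` has no atom at `0`. -/
def IsPosMoment (s : ℕ → ℝ) : Prop :=
  ∃ (Ω : Type) (_ : MeasurableSpace Ω) (μ : Measure Ω) (X : Ω → ℝ),
    IsFiniteMeasure μ ∧ Measurable X ∧ (∀ᵐ ω ∂μ, 0 < X ω ∧ X ω ≤ 1) ∧
      ∀ m : ℕ, s m = ∫ ω, X ω ^ m ∂μ

theorem isPosMoment_one : IsPosMoment (fun _ => 1) :=
  ⟨Unit, inferInstance, Measure.dirac (), fun _ => 1, inferInstance, measurable_const,
    by simp, by simp⟩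

theorem IsPosMoment.mul {s t : ℕ → ℝ} (hs : IsPosMoment s) (ht : IsPosMoment t) :
    IsPosMoment (fun m => s m * t m) := by
  obtain ⟨Ω, _, μ, X, _, hX, hX01, hsX⟩ := hs
  obtain ⟨Ω', _, ν, Y, _, hY, hY01, htY⟩ := ht
  refine ⟨Ω × Ω', inferInstance, μ.prod ν, fun p => X p.1 * Y p.2, inferInstance,
    by fun_prop, ?_, fun m => ?_⟩
  · filter_upwards [Measure.quasiMeasurePreserving_fst.ae hX01,
      Measure.quasiMeasurePreserving_snd.ae hY01] with p hx hy
    exact ⟨mul_pos hx.1 hy.1, mul_le_one₀ hx.2 hy.1.le hy.2⟩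
  · simp_rw [hsX, htY, mul_pow]
    exact (integral_prod_mul (fun x => X x ^ m) (fun y => Y y ^ m)).symm

theorem IsPosMoment.const_mul {s : ℕ → ℝ} (hs : IsPosMoment s) {c : ℝ} (hc : 0 < c) :
    IsPosMoment (fun m => c * s m) := by
  obtain ⟨Ω, _, μ, X, _, hX, hX01, hsX⟩ := hs
  refine ⟨Ω, inferInstance, c.toNNReal • μ, X, inferInstance, hX,
    Measure.ae_smul_measure hX01 _, fun m => ?_⟩
  beta_reduce
  rw [integral_smul_nnreal_measure, hsX, NNReal.smul_def, Real.coe_toNNReal c hc.le, smul_eq_mul]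

theorem isPosMoment_inv_add {b : ℝ} (hb : 0 < b) : IsPosMoment (fun m => ((m : ℝ) + b)⁻¹) := by
  have h : IsPosMoment (fun m => b * ((m : ℝ) + b)⁻¹) := by
    refine ⟨ℝ, inferInstance, volume.restrict (Set.Ioc 0 1), fun u => u ^ b⁻¹, inferInstance,
      by fun_prop, ?_, fun m => ?_⟩
    · filter_upwards [ae_restrict_mem measurableSet_Ioc] with u hu
      exact ⟨Real.rpow_pos_of_pos hu.1 _, Real.rpow_le_one hu.1.le hu.2 (by positivity)⟩
    · have hm : 0 < b⁻¹ * m + 1 := by positivity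
      have : ∫ u in Set.Ioc (0 : ℝ) 1, (u ^ b⁻¹) ^ m = ∫ u in Set.Ioc (0 : ℝ) 1, u ^ (b⁻¹ * m) := by
        refine setIntegral_congr_fun measurableSet_Ioc fun u hu => ?_
        simp only [Real.rpow_mul_natCast hu.1.le]
      rw [this, ← intervalIntegral.integral_of_le zero_le_one,
        integral_rpow (Or.inl (by linarith)), Real.one_rpow, Real.zero_rpow hm.ne']
      field_simp
      ring
  convert h.const_mul (inv_pos.mpr hb) using 2
  field_simp

theorem IsPosMoment.prod {ι : Type*} (S : Finset ι) {s : ι → ℕ → ℝ}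
    (hs : ∀ i ∈ S, IsPosMoment (s i)) : IsPosMoment (fun m => ∏ i ∈ S, s i m) := by
  classical
  induction S using Finset.induction_on with
  | empty => simpa using isPosMoment_one
  | insert i S hi ih =>
    simp_rw [Finset.prod_insert hi]
    exact (hs i (Finset.mem_insert_self i S)).mul
      (ih fun j hj => hs j (Finset.mem_insert_of_mem hj))

theorem IsPosMoment.not_compMono_sub {s : ℕ → ℝ} (hs : IsPosMoment s) {ε : ℝ} (hε : 0 < ε) :
    ¬ CompMono (fun k => s k - if k = 0 then ε else 0) := by
  obtain ⟨Ω, _, μ, X, _, hX, hX01, hsX⟩ := hs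
  have hbound : ∀ N m : ℕ, ∀ᵐ ω ∂μ, ‖X ω ^ m * (1 - X ω) ^ N‖ ≤ 1 := fun N m => by
    filter_upwards [hX01] with ω hω
    have h1 : 0 ≤ 1 - X ω := by linarith
    rw [Real.norm_of_nonneg (mul_nonneg (pow_nonneg hω.1.le _) (pow_nonneg h1 _))]
    exact mul_le_one₀ (pow_le_one₀ hω.1.le hω.2) (pow_nonneg h1 _)
      (pow_le_one₀ h1 (by linarith))
  have hint : ∀ N m : ℕ, Integrable (fun ω => X ω ^ m * (1 - X ω) ^ N) μ := fun N m =>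
    Integrable.of_bound (by fun_prop) 1 (hbound N m)
  have hdiff : ∀ N m : ℕ, (-1 : ℝ) ^ N * dSeq^[N] (fun k => s k - if k = 0 then ε else 0) m =
      (∫ ω, X ω ^ m * (1 - X ω) ^ N ∂μ) - if m = 0 then ε else 0 := by
    intro N
    induction N with
    | zero => intro m; simp [hsX]
    | succ N ih =>
      intro m
      have hsplit : ∫ ω, X ω ^ m * (1 - X ω) ^ (N + 1) ∂μ =
          (∫ ω, X ω ^ m * (1 - X ω) ^ N ∂μ) - ∫ ω, X ω ^ (m + 1) * (1 - X ω) ^ N ∂μ := by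
        rw [← integral_sub (hint N m) (hint N (m + 1))]
        congr 1 with ω
        ring
      have h0 := ih m
      have h1 := ih (m + 1)
      rw [if_neg m.succ_ne_zero] at h1
      rw [Function.iterate_succ_apply', dSeq, hsplit, pow_succ]
      linear_combination h0 - h1
  have hlim : Tendsto (fun N : ℕ => ∫ ω, X ω ^ 0 * (1 - X ω) ^ N ∂μ) atTop (𝓝 0) := by
    have := tendsto_integral_of_dominated_convergence (μ := μ) (f := fun _ => (0 : ℝ))
      (F := fun N ω => X ω ^ 0 * (1 - X ω) ^ N) (fun _ => 1)
      (fun N => by fun_prop) (integrable_const _) (fun N => hbound N 0) (by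
        filter_upwards [hX01] with ω hω
        simpa using tendsto_pow_atTop_nhds_zero_of_lt_one (r := 1 - X ω)
          (by linarith) (by linarith))
    simpa using this
  intro hcm
  obtain ⟨N, hN⟩ := (hlim.eventually (gt_mem_nhds hε)).exists
  have h := hcm N 0
  rw [hdiff, if_pos rfl] at h
  linarith

theorem statement8 (k : ℕ) (hk : 0 < k) (a₀ b₀ : ℝ) (ha₀ : 0 < a₀) (hb₀ : 0 < b₀)
    (A B : ℕ → ℝ)
    (hA : ∀ j, 1 ≤ j → j ≤ k → 0 < A j) (hB : ∀ j, 1 ≤ j → j ≤ k → 0 < B j)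
    (hjcm : JointCompMono (fun m n =>
      1 / (b₀ * ∏ j ∈ Finset.Icc 1 k, ((m : ℝ) + B j) +
        (a₀ * ∏ j ∈ Finset.Icc 1 k, ((m : ℝ) + A j)) * n))) :
    MinJointCompMono (fun m n =>
      1 / (b₀ * ∏ j ∈ Finset.Icc 1 k, ((m : ℝ) + B j) +
        (a₀ * ∏ j ∈ Finset.Icc 1 k, ((m : ℝ) + A j)) * n)) := by
  refine ⟨hjcm, fun ε hε => ?_, fun ε hε => ?_⟩
  · have hP := (IsPosMoment.prod (Finset.Icc 1 k) (s := fun j m => ((m : ℝ) + B j)⁻¹)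
      fun j hj => isPosMoment_inv_add
        (hB j (Finset.mem_Icc.mp hj).1 (Finset.mem_Icc.mp hj).2)).const_mul (inv_pos.mpr hb₀)
    convert hP.not_compMono_sub hε using 4 with m
    simp [Finset.prod_inv_distrib, mul_comm]
  · have ha : 0 < a₀ * ∏ j ∈ Finset.Icc 1 k, (((0 : ℕ) : ℝ) + A j) :=
      mul_pos ha₀ (Finset.prod_pos fun j hj => by
        simpa using hA j (Finset.mem_Icc.mp hj).1 (Finset.mem_Icc.mp hj).2)
    have hb : 0 < b₀ * ∏ j ∈ Finset.Icc 1 k, (((0 : ℕ) : ℝ) + B j) :=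
      mul_pos hb₀ (Finset.prod_pos fun j hj => by
        simpa using hB j (Finset.mem_Icc.mp hj).1 (Finset.mem_Icc.mp hj).2)
    convert ((isPosMoment_inv_add (div_pos hb ha)).const_mul
      (inv_pos.mpr ha)).not_compMono_sub hε using 4 with n
    beta_reduce
    rw [← mul_inv, one_div, mul_add, mul_div_cancel₀ _ ha.ne', add_comm]
end
end
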